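/- Let k ≥ 1, let c(i,j) be integers for 1 ≤ i < j ≤ k with c(i,i) := 1, and let b(i,j) be the associated Bott numbers. Let π_k : ℤ^{2k} → ℤ^k be the ℤ-linear map sending e_{2r-1} ↦ e_r and e_{2r} ↦ ∑_{m=r}^{k} b(r,m) e_m for 1 ≤ r ≤ k. Then the kernel of π_k is a free ℤ-module of rank k with basis the vectors v_r := e_{2r-1} + ∑_{s=r}^{k} c(r,s) e_{2s}, r = 1,…,k (so v_r = (0,…,0, 1, c(r,r), 0, c(r,r+1), 0, …, 0, c(r,k)) with the 1 in position 2r-1). -/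

import Mathlib

/-- The matrix of the map `π_k : ℤ^{2k} → ℤ^k` sending `e_{2r-1} ↦ e_r` and
`e_{2r} ↦ ∑_{m=r}^{k} b r m • e_m` (1-based; recall `b r m = 0` for `m < r`).
Rows are indexed by `Fin k`, columns by `Fin (2k)`, both 0-based. -/
def piMat (b : ℕ → ℕ → ℤ) (k : ℕ) : Matrix (Fin k) (Fin (2 * k)) ℤ :=
  Matrix.of fun m t =>
    if (t : ℕ) % 2 = 0 then (if (m : ℕ) = (t : ℕ) / 2 then 1 else 0)
    else b ((t : ℕ) / 2 + 1) ((m : ℕ) + 1)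

/-- The vector `v_r = e_{2r-1} + ∑_{s=r}^{k} c r s • e_{2s} ∈ ℤ^{2k}` (1-based `r`
corresponds to `r : Fin k` via `r+1`). -/
def vKer (c : ℕ → ℕ → ℤ) (k : ℕ) (r : Fin k) : Fin (2 * k) → ℤ :=
  fun t => (if (t : ℕ) = 2 * (r : ℕ) then 1 else 0) +
    (if (t : ℕ) % 2 = 1 ∧ (r : ℕ) ≤ (t : ℕ) / 2 then c ((r : ℕ) + 1) ((t : ℕ) / 2 + 1) else 0)

theorem sum_two_mul_aux (k : ℕ) (g : Fin (2 * k) → ℤ) :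
    ∑ t, g t = ∑ i : Fin k, (g ⟨2 * i, by omega⟩ + g ⟨2 * i + 1, by omega⟩) := by
  induction k with
  | zero => simp
  | succ n ih =>
    have h1 : ∑ t, g t = ∑ t : Fin (2 * n + 1 + 1), g t := rfl
    rw [h1, Fin.sum_univ_castSucc, Fin.sum_univ_castSucc, Fin.sum_univ_castSucc, add_assoc]
    exact congrArg (· + _) (ih (fun t => g ⟨t, by omega⟩))

/-- The matrix C. -/
def cMatAux (c : ℕ → ℕ → ℤ) (k : ℕ) : Matrix (Fin k) (Fin k) ℤ :=
  Matrix.of fun r s => if (r : ℕ) ≤ s then c (r + 1) (s + 1) else 0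

/-- The matrix B. -/
def bMatAux (b : ℕ → ℕ → ℤ) (k : ℕ) : Matrix (Fin k) (Fin k) ℤ :=
  Matrix.of fun r s => b (r + 1) (s + 1)

theorem cb_aux (k : ℕ) (c b : ℕ → ℕ → ℤ)
    (hc : ∀ i, 1 ≤ i → i ≤ k → c i i = 1)
    (hbdiag : ∀ i, 1 ≤ i → i ≤ k → b i i = -1)
    (hbzero : ∀ i j, 1 ≤ j → j < i → i ≤ k → b i j = 0)
    (hbrec : ∀ i j, 1 ≤ i → i < j → j ≤ k →
      b i j = -∑ m ∈ Finset.Ioc i j, c i m * b m j) :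
    cMatAux c k * bMatAux b k = -1 := by
  ext i j
  obtain ⟨i, hi⟩ := i
  obtain ⟨j, hj⟩ := j
  simp only [Matrix.mul_apply, cMatAux, bMatAux, Matrix.of_apply, Matrix.neg_apply,
    Matrix.one_apply, Fin.mk.injEq]
  rw [Fin.sum_univ_eq_sum_range (fun n => (if i ≤ n then c (i + 1) (n + 1) else 0) *
    b (n + 1) (j + 1)) k]
  by_cases hij : i ≤ j
  · rw [← Finset.sum_subset (s₁ := Finset.Icc i j)]
    · rw [← Finset.add_sum_Ioc_eq_sum_Icc hij]
      have h2 : ∑ n ∈ Finset.Ioc i j, (if i ≤ n then c (i + 1) (n + 1) else 0) *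
          b (n + 1) (j + 1) = ∑ m ∈ Finset.Ioc (i + 1) (j + 1), c (i + 1) m * b m (j + 1) := by
        rw [← Finset.map_add_right_Ioc, Finset.sum_map]
        apply Finset.sum_congr rfl
        intro n hn
        rw [Finset.mem_Ioc] at hn
        simp [hn.1.le]
      rw [h2, if_pos le_rfl, hc _ (by omega) (by omega)]
      rcases hij.eq_or_lt with h | h
      · subst h
        simp [hbdiag (i + 1) (by omega) (by omega)]
      · rw [hbrec (i + 1) (j + 1) (by omega) (by omega) (by omega), if_neg h.ne]
        ring
    · intro n hn
      simp only [Finset.mem_Icc, Finset.mem_range] at *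
      omega
    · intro n hn hn'
      simp only [Finset.mem_Icc, Finset.mem_range] at *
      by_cases h : i ≤ n
      · rw [hbzero (n + 1) (j + 1) (by omega) (by omega) (by omega), mul_zero]
      · rw [if_neg h, zero_mul]
  · rw [if_neg (by omega), neg_zero]
    apply Finset.sum_eq_zero
    intro n hn
    rw [Finset.mem_range] at hn
    by_cases h : i ≤ n
    · rw [hbzero (n + 1) (j + 1) (by omega) (by omega) (by omega), mul_zero]
    · rw [if_neg h, zero_mul]

theorem pi_aux (b : ℕ → ℕ → ℤ) (k : ℕ) (x : Fin (2 * k) → ℤ) :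
    (piMat b k).mulVec x = (fun i : Fin k => x ⟨2 * i, by omega⟩) +
      Matrix.vecMul (fun i : Fin k => x ⟨2 * i + 1, by omega⟩) (bMatAux b k) := by
  ext m
  simp only [Matrix.mulVec, dotProduct, Matrix.vecMul, Pi.add_apply]
  rw [sum_two_mul_aux, Finset.sum_add_distrib]
  congr 1
  · rw [Finset.sum_eq_single m]
    · simp [piMat]
    · intro i _ hi
      have : (m : ℕ) ≠ i := fun h => hi (Fin.ext h.symm)
      simp [piMat, this]
    · simp
  · apply Finset.sum_congr rfl
    intro i _
    have h1 : (2 * (i : ℕ) + 1) % 2 = 1 := by omega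
    have h2 : (2 * (i : ℕ) + 1) / 2 = i := by omega
    simp only [piMat, bMatAux, Matrix.of_apply, h1, h2, one_ne_zero, if_false]
    exact mul_comm _ _

theorem v_even_aux (c : ℕ → ℕ → ℤ) (k : ℕ) (p : Fin k → ℤ) :
    (fun i : Fin k => (∑ r, p r • vKer c k r) ⟨2 * i, by omega⟩) = p := by
  ext i
  rw [Finset.sum_apply, Finset.sum_eq_single i]
  · simp [vKer]
  · intro r _ hr
    have : (i : ℕ) ≠ r := fun h => hr (Fin.ext h.symm)
    simp [vKer, this]
  · simp

theorem v_odd_aux (c : ℕ → ℕ → ℤ) (k : ℕ) (p : Fin k → ℤ) :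
    (fun i : Fin k => (∑ r, p r • vKer c k r) ⟨2 * i + 1, by omega⟩) =
      Matrix.vecMul p (cMatAux c k) := by
  ext i
  simp only [Matrix.vecMul, dotProduct]
  rw [Finset.sum_apply]
  apply Finset.sum_congr rfl
  intro r _
  have h1 : (2 * (i : ℕ) + 1) % 2 = 1 := by omega
  have h2 : (2 * (i : ℕ) + 1) / 2 = i := by omega
  have h3 : 2 * (i : ℕ) + 1 ≠ 2 * r := by omega
  simp [vKer, cMatAux, h1, h2, h3]

/-- the kernel of `π_k` is a free `ℤ`-module of rank `k` with basis the
vectors `v_r = e_{2r-1} + ∑_{s=r}^{k} c(r,s) e_{2s}`, `r = 1, …, k`. -/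
theorem ker_pi_free_of_rank_k (k : ℕ) (hk : 1 ≤ k) (c b : ℕ → ℕ → ℤ)
    (hc : ∀ i, 1 ≤ i → i ≤ k → c i i = 1)
    (hbdiag : ∀ i, 1 ≤ i → i ≤ k → b i i = -1)
    (hbzero : ∀ i j, 1 ≤ j → j < i → i ≤ k → b i j = 0)
    (hbrec : ∀ i j, 1 ≤ i → i < j → j ≤ k →
      b i j = -∑ m ∈ Finset.Ioc i j, c i m * b m j) :
    ∃ β : Module.Basis (Fin k) ℤ (LinearMap.ker (Matrix.mulVecLin (piMat b k))),
      ∀ r : Fin k, ((β r : LinearMap.ker (Matrix.mulVecLin (piMat b k))) : Fin (2 * k) → ℤ)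
        = vKer c k r := by
  have hCB := cb_aux k c b hc hbdiag hbzero hbrec
  have hBC : bMatAux b k * cMatAux c k = -1 := by
    have h : (-cMatAux c k) * bMatAux b k = 1 := by rw [Matrix.neg_mul, hCB, neg_neg]
    have h' := mul_eq_one_comm.mp h
    rw [Matrix.mul_neg] at h'
    rw [← h', neg_neg]
  let e : LinearMap.ker (Matrix.mulVecLin (piMat b k)) ≃ₗ[ℤ] (Fin k → ℤ) :=
    { toFun := fun x i => x.1 ⟨2 * i, by omega⟩
      map_add' := fun x y => rfl
      map_smul' := fun a x => rfl
      invFun := fun p => ⟨∑ r, p r • vKer c k r, by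
        rw [LinearMap.mem_ker, Matrix.mulVecLin_apply, pi_aux, v_even_aux, v_odd_aux,
          Matrix.vecMul_vecMul, hCB, Matrix.vecMul_neg, Matrix.vecMul_one, add_neg_cancel]⟩
      left_inv := by
        rintro ⟨x, hx⟩
        rw [LinearMap.mem_ker, Matrix.mulVecLin_apply, pi_aux] at hx
        have ho := v_odd_aux c k (fun i : Fin k => x ⟨2 * i, by omega⟩)
        have he := v_even_aux c k (fun i : Fin k => x ⟨2 * i, by omega⟩)
        rw [eq_neg_of_add_eq_zero_left hx, Matrix.neg_vecMul, Matrix.vecMul_vecMul, hBC,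
          Matrix.vecMul_neg, Matrix.vecMul_one, neg_neg] at ho
        apply Subtype.ext
        funext ⟨t, ht⟩
        rcases Nat.even_or_odd' t with ⟨s, rfl | rfl⟩
        · exact congrFun he ⟨s, by omega⟩
        · exact congrFun ho ⟨s, by omega⟩
      right_inv := fun p => v_even_aux c k p }
  refine ⟨Module.Basis.ofEquivFun e, fun r => ?_⟩
  rw [Module.Basis.coe_ofEquivFun]
  change ∑ s, (Pi.single r (1 : ℤ) : Fin k → ℤ) s • vKer c k s = _
  rw [Finset.sum_eq_single r]
  · simp
  · intro s _ hs
    simp [hs]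
  · simp
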